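/- Fix ε with 0 < ε < 1/2 and let ζ(r,n) = n^{−1/(log n)^{ε}}. Then no infinite family of metafunnels is up-to-ζ fixating; that is, for every infinite set F ⊆ ℤ_{≥1}³ of parameter triples, the family of (k,ℓ,m)-metafunnels with (k,ℓ,m)∈F is not up-to-ζ fixating. -/

import Mathlib

open Finset

/-- Total fitness of the mutant set `S` (mutants have fitness `r`, non-mutants fitness `1`). -/
noncomputable def moranW {V : Type*} [Fintype V] (r : ℝ) (S : Finset V) : ℝ :=
  r * S.card + ((Fintype.card V : ℝ) - S.card)

/-- One-step transition probability of the Moran process with fitness `r` and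
reproduction weights `w`, from mutant set `S` to mutant set `T`:  a vertex `u` is chosen
with probability `r / moranW r S` if it is a mutant and `1 / moranW r S` otherwise, then a
target `v` is chosen with probability `w u v`, and `v` becomes a mutant if `u` is one and
a non-mutant otherwise. -/
noncomputable def moranStep {V : Type*} [Fintype V] [DecidableEq V]
    (r : ℝ) (w : V → V → ℝ) (S T : Finset V) : ℝ :=
  ∑ u : V, ∑ v : V,
    ((if u ∈ S then r else 1) / moranW r S) * w u v *
      (if (if u ∈ S then insert v S else S.erase v) = T then 1 else 0)

/-- Distribution of the Moran process after `t` steps, from initial distribution `init`. -/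
noncomputable def moranDist {V : Type*} [Fintype V] [DecidableEq V]
    (r : ℝ) (w : V → V → ℝ) (init : Finset V → ℝ) : ℕ → Finset V → ℝ
  | 0 => init
  | t + 1 => fun T => ∑ S : Finset V, moranDist r w init t S * moranStep r w S T

/-- Reproduction weights of the (unweighted) Moran process on the digraph with
out-neighbourhoods `out`: the offspring goes to a uniformly random out-neighbour. -/
noncomputable def outWeights {V : Type*} [DecidableEq V]
    (out : V → Finset V) : V → V → ℝ :=
  fun u v => if v ∈ out u then ((out u).card : ℝ)⁻¹ else 0

/-- Extinction probability: `sup_t Pr(S_t = ∅)`. -/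
noncomputable def extinctionProb {V : Type*} [Fintype V] [DecidableEq V]
    (r : ℝ) (w : V → V → ℝ) (init : Finset V → ℝ) : ℝ :=
  ⨆ t : ℕ, moranDist r w init t (∅ : Finset V)

/-- Fixation probability: `sup_t Pr(S_t = V)`. -/
noncomputable def fixationProb {V : Type*} [Fintype V] [DecidableEq V]
    (r : ℝ) (w : V → V → ℝ) (init : Finset V → ℝ) : ℝ :=
  ⨆ t : ℕ, moranDist r w init t (Finset.univ : Finset V)

/-- Initial distribution: a single mutant at a uniformly random vertex. -/
noncomputable def uniformSingleton (V : Type*) [Fintype V] [DecidableEq V] :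
    Finset V → ℝ :=
  fun S => if S.card = 1 then (Fintype.card V : ℝ)⁻¹ else 0

/-- Initial distribution: a single mutant at the fixed vertex `x₀`. -/
def pointInit {V : Type*} [DecidableEq V] (x₀ : V) : Finset V → ℝ :=
  fun S => if S = {x₀} then 1 else 0

/-- Vertices of the `(k,ℓ,m)`-metafunnel: the centre `v*` (`Sum.inl ()`) together with,
for each level index `i : Fin k` (representing level `i+1`) and each copy `j : Fin ℓ`,
a set `V_{i+1,j}` of `m ^ (i+1)` vertices.  It has `1 + ℓ·∑_{i=1}^k m^i` vertices. -/
abbrev MetafunnelV (k ℓ m : ℕ) : Type :=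
  Unit ⊕ (Σ i : Fin k, Fin ℓ × Fin (m ^ ((i : ℕ) + 1)))

/-- The level of a metafunnel vertex: the centre has level `0` and the vertices of
`V_{i,j}` have level `i`. -/
def mfLevel {k ℓ m : ℕ} : MetafunnelV k ℓ m → ℕ
  | Sum.inl _ => 0
  | Sum.inr ⟨i, _⟩ => (i : ℕ) + 1

/-- The copy of a metafunnel vertex: `some j` for a vertex of `V_{i,j}`, and `none` for
the centre. -/
def mfCopy {k ℓ m : ℕ} : MetafunnelV k ℓ m → Option (Fin ℓ)
  | Sum.inl _ => none
  | Sum.inr ⟨_, j, _⟩ => some j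

/-- Out-neighbourhoods of the `(k,ℓ,m)`-metafunnel: the centre points to all of `V_k`,
each vertex of `V_1` points to the centre, and each vertex of `V_{i+1,j}` points to all
of `V_{i,j}`. -/
def metafunnelOut (k ℓ m : ℕ) : MetafunnelV k ℓ m → Finset (MetafunnelV k ℓ m)
  | Sum.inl _ => Finset.univ.filter fun v => mfLevel v = k
  | Sum.inr ⟨i, j, _⟩ =>
      if (i : ℕ) = 0 then {Sum.inl ()}
      else Finset.univ.filter fun v => mfLevel v = (i : ℕ) ∧ mfCopy v = some j

/-- The family of `(k,ℓ,m)`-metafunnels with parameter triples in `F` is up-to-`ζ`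
fixating: for every `r > 1` there is an `n₀` such that every metafunnel in the family
with `n ≥ n₀` vertices has extinction probability at most `ζ r n` for the Moran process
with fitness `r` started from a single uniformly random initial mutant. -/
def UpToZetaFixatingMetafunnels (ζ : ℝ → ℕ → ℝ) (F : Set (ℕ × ℕ × ℕ)) : Prop :=
  ∀ r : ℝ, 1 < r → ∃ n₀ : ℕ, ∀ k ℓ m : ℕ, (k, ℓ, m) ∈ F →
    n₀ ≤ Fintype.card (MetafunnelV k ℓ m) →
    extinctionProb r (outWeights (metafunnelOut k ℓ m))
        (uniformSingleton (MetafunnelV k ℓ m)) ≤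
      ζ r (Fintype.card (MetafunnelV k ℓ m))


section Generic

variable {V : Type*} [Fintype V] [DecidableEq V]

/-- The state after `u` reproduces onto `v`. -/
def mfNext (S : Finset V) (u v : V) : Finset V :=
  if u ∈ S then insert v S else S.erase v

/-- Unnormalised drift of `g` at `S`. -/
noncomputable def mfDrift (r : ℝ) (w : V → V → ℝ) (g : Finset V → ℝ) (S : Finset V) : ℝ :=
  ∑ u : V, ∑ v : V, (if u ∈ S then r else 1) * w u v * (g (mfNext S u v) - g S)

lemma moranW_pos [Nonempty V] {r : ℝ} (hr : 1 < r) (S : Finset V) : 0 < moranW r S := by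
  unfold moranW
  have h1 : (S.card : ℝ) ≤ Fintype.card V := by exact_mod_cast S.card_le_univ
  have h2 : (0 : ℝ) < Fintype.card V := by exact_mod_cast Fintype.card_pos
  have h3 : (0 : ℝ) ≤ S.card := by positivity
  nlinarith

lemma sum_fit (r : ℝ) (S : Finset V) :
    ∑ u : V, (if u ∈ S then r else 1) = moranW r S := by
  unfold moranW
  rw [Finset.sum_ite]
  simp only [Finset.sum_const, nsmul_eq_mul, mul_one, Finset.filter_mem_eq_inter,
    Finset.univ_inter]
  have : (Finset.univ.filter fun x => x ∉ S) = Sᶜ := by ext; simp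
  rw [this, Finset.card_compl, Nat.cast_sub S.card_le_univ]
  ring

lemma step_sum (r : ℝ) (w : V → V → ℝ) (S : Finset V) (g : Finset V → ℝ) :
    ∑ T, moranStep r w S T * g T =
      ∑ u : V, ∑ v : V, ((if u ∈ S then r else 1) / moranW r S) * w u v * g (mfNext S u v) := by
  unfold moranStep
  simp_rw [Finset.sum_mul]
  rw [Finset.sum_comm]
  refine Finset.sum_congr rfl fun u _ => ?_
  rw [Finset.sum_comm]
  refine Finset.sum_congr rfl fun v _ => ?_
  rw [Finset.sum_eq_single (mfNext S u v)]
  · simp [mfNext]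
  · intro T _ hT
    have : ¬ ((if u ∈ S then insert v S else S.erase v) = T) := fun h => hT h.symm
    rw [if_neg this]; ring
  · simp

lemma step_sum_drift [Nonempty V] {r : ℝ} (hr : 1 < r) {w : V → V → ℝ}
    (hw1 : ∀ u, ∑ v, w u v = 1) (S : Finset V) (g : Finset V → ℝ) :
    ∑ T, moranStep r w S T * g T = g S + mfDrift r w g S / moranW r S := by
  have hW := (moranW_pos hr S).ne'
  rw [step_sum]
  unfold mfDrift
  simp_rw [mul_sub, Finset.sum_sub_distrib]
  have h2 : ∑ u : V, ∑ v : V, (if u ∈ S then r else 1) * w u v * g S = moranW r S * g S := by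
    rw [← sum_fit, Finset.sum_mul]
    refine Finset.sum_congr rfl fun u _ => ?_
    rw [← Finset.sum_mul, ← Finset.mul_sum, hw1]; ring
  rw [h2, sub_div, mul_div_cancel_left₀ _ hW]
  simp_rw [Finset.sum_div]
  rw [add_sub_cancel]
  refine Finset.sum_congr rfl fun u _ => Finset.sum_congr rfl fun v _ => ?_
  ring

lemma moranStep_nonneg [Nonempty V] {r : ℝ} (hr : 1 < r) {w : V → V → ℝ}
    (hw0 : ∀ u v, 0 ≤ w u v) (S T : Finset V) : 0 ≤ moranStep r w S T := by
  unfold moranStep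
  refine Finset.sum_nonneg fun u _ => Finset.sum_nonneg fun v _ => ?_
  have hW := moranW_pos hr S
  have := hw0 u v
  have h3 : (0 : ℝ) ≤ if u ∈ S then r else 1 := by split_ifs <;> linarith
  refine mul_nonneg (mul_nonneg (div_nonneg h3 hW.le) this) ?_
  split_ifs <;> norm_num

lemma moranDist_nonneg [Nonempty V] {r : ℝ} (hr : 1 < r) {w : V → V → ℝ}
    (hw0 : ∀ u v, 0 ≤ w u v) {init : Finset V → ℝ} (hi : ∀ S, 0 ≤ init S) (t : ℕ) :
    ∀ S, 0 ≤ moranDist r w init t S := by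
  induction t with
  | zero => exact hi
  | succ t ih =>
    intro S
    exact Finset.sum_nonneg fun T _ => mul_nonneg (ih T) (moranStep_nonneg hr hw0 T S)

lemma moranDist_exp_succ [Nonempty V] {r : ℝ} (hr : 1 < r) {w : V → V → ℝ}
    (hw1 : ∀ u, ∑ v, w u v = 1) (init : Finset V → ℝ) (g : Finset V → ℝ) (t : ℕ) :
    ∑ S, moranDist r w init (t + 1) S * g S =
      ∑ S, moranDist r w init t S * g S +
      ∑ S, moranDist r w init t S * (mfDrift r w g S / moranW r S) := by
  rw [← Finset.sum_add_distrib]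
  simp only [moranDist]
  simp_rw [Finset.sum_mul]
  rw [Finset.sum_comm]
  refine Finset.sum_congr rfl fun S _ => ?_
  rw [← mul_add, ← step_sum_drift hr hw1, Finset.mul_sum]
  refine Finset.sum_congr rfl fun T _ => ?_
  ring

lemma moranDist_total [Nonempty V] {r : ℝ} (hr : 1 < r) {w : V → V → ℝ}
    (hw1 : ∀ u, ∑ v, w u v = 1) {init : Finset V → ℝ} (hi1 : ∑ S, init S = 1) (t : ℕ) :
    ∑ S, moranDist r w init t S = 1 := by
  induction t with
  | zero => exact hi1
  | succ t ih =>
    have := moranDist_exp_succ hr hw1 init (fun _ => 1) t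
    simpa [mfDrift, ih] using this

/-- Extinction lower bound by a strict submartingale. -/
lemma ext_lower [Nonempty V] {r : ℝ} (hr : 1 < r) {w : V → V → ℝ}
    (hw0 : ∀ u v, 0 ≤ w u v) (hw1 : ∀ u, ∑ v, w u v = 1)
    {init : Finset V → ℝ} (hi : ∀ S, 0 ≤ init S) (hi1 : ∑ S, init S = 1)
    (g : Finset V → ℝ) (hg0 : ∀ S, 0 ≤ g S) (hg1 : ∀ S, g S ≤ 1) (hge : g ∅ = 1)
    (hd : ∀ S, S.Nonempty → 0 < g S → 0 < mfDrift r w g S) :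
    ∑ S, init S * g S ≤ extinctionProb r w init := by
  set x : ℕ → ℝ := fun t => ∑ S, moranDist r w init t S * g S with hx
  have hdist0 := moranDist_nonneg hr hw0 hi
  have hdist1 := moranDist_total hr hw1 hi1
  set h : Finset V → ℝ := fun S => mfDrift r w g S / moranW r S with hh
  have hh0 : ∀ S, 0 ≤ h S := by
    intro S
    refine div_nonneg ?_ (moranW_pos hr S).le
    rcases S.eq_empty_or_nonempty with rfl | hS
    · simp [mfDrift, mfNext]
    rcases (hg0 S).eq_or_lt with h0 | h0
    · unfold mfDrift
      refine Finset.sum_nonneg fun u _ => Finset.sum_nonneg fun v _ => ?_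
      rw [← h0, sub_zero]
      have h3 : (0 : ℝ) ≤ if u ∈ S then r else 1 := by split_ifs <;> linarith
      exact mul_nonneg (mul_nonneg h3 (hw0 u v)) (hg0 _)
    · exact (hd S hS h0).le
  have hhpos : ∀ S, S.Nonempty → 0 < g S → 0 < h S := fun S hS h0 =>
    div_pos (hd S hS h0) (moranW_pos hr S)
  set C : ℝ := ∑ S, g S / h S with hC
  have hCb : ∀ S, S.Nonempty → g S ≤ C * h S := by
    intro S hS
    rcases (hg0 S).eq_or_lt with h0 | h0
    · rw [← h0]
      exact mul_nonneg (Finset.sum_nonneg fun S _ => div_nonneg (hg0 S) (hh0 S)) (hh0 S)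
    · have hp := hhpos S hS h0
      rw [← div_le_iff₀ hp]
      exact Finset.single_le_sum (f := fun S => g S / h S)
        (fun S _ => div_nonneg (hg0 S) (hh0 S)) (Finset.mem_univ S)
  have hC0 : 0 ≤ C := Finset.sum_nonneg fun S _ => div_nonneg (hg0 S) (hh0 S)
  have hsucc : ∀ t, x (t + 1) = x t + ∑ S, moranDist r w init t S * h S :=
    fun t => moranDist_exp_succ hr hw1 init g t
  have hmono : Monotone x := monotone_nat_of_le_succ fun t => by
    rw [hsucc]
    have : 0 ≤ ∑ S, moranDist r w init t S * h S :=
      Finset.sum_nonneg fun S _ => mul_nonneg (hdist0 t S) (hh0 S)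
    linarith
  have hxb : ∀ t, x t ≤ 1 := by
    intro t
    rw [← hdist1 t]
    exact Finset.sum_le_sum fun S _ => mul_le_of_le_one_right (hdist0 t S) (hg1 S)
  have hbdd : BddAbove (Set.range x) := ⟨1, by rintro _ ⟨t, rfl⟩; exact hxb t⟩
  have hlim := tendsto_atTop_ciSup hmono hbdd
  have hlim1 := (Filter.tendsto_add_atTop_iff_nat 1).2 hlim
  have hlim2 : Filter.Tendsto (fun t => x 0 - C * (x (t + 1) - x t)) Filter.atTop
      (nhds (x 0 - C * ((⨆ t, x t) - ⨆ t, x t))) :=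
    ((hlim1.sub hlim).const_mul C).const_sub (x 0)
  rw [sub_self, mul_zero, sub_zero] at hlim2
  refine le_of_tendsto' hlim2 fun t => ?_
  have hE : moranDist r w init t ∅ ≤ extinctionProb r w init := by
    refine le_ciSup (f := fun t => moranDist r w init t ∅) ⟨1, ?_⟩ t
    rintro _ ⟨s, rfl⟩
    rw [← hdist1 s]
    exact Finset.single_le_sum (fun S _ => hdist0 s S) (Finset.mem_univ ∅)
  refine le_trans ?_ hE
  have h0t : x 0 ≤ x t := hmono (Nat.zero_le t)
  have hkey : x t ≤ moranDist r w init t ∅ + C * (x (t + 1) - x t) := by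
    rw [hsucc, add_sub_cancel_left, Finset.mul_sum, hx]
    simp only
    rw [← Finset.add_sum_erase _ _ (Finset.mem_univ (∅ : Finset V)), hge, mul_one]
    gcongr
    refine le_trans (Finset.sum_le_sum (g := fun S => C * (moranDist r w init t S * h S)) ?_) ?_
    · intro S hS
      have := hCb S (Finset.nonempty_iff_ne_empty.2 (Finset.ne_of_mem_erase hS))
      have := mul_le_mul_of_nonneg_left this (hdist0 t S)
      linarith
    · refine Finset.sum_le_sum_of_subset_of_nonneg (Finset.erase_subset _ _) fun S _ _ => ?_
      exact mul_nonneg hC0 (mul_nonneg (hdist0 t S) (hh0 S))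
  linarith

lemma sum_uniformSingleton_mul (g : Finset V → ℝ) :
    ∑ S, uniformSingleton V S * g S = (Fintype.card V : ℝ)⁻¹ * ∑ v : V, g {v} := by
  unfold uniformSingleton
  simp_rw [ite_mul, zero_mul]
  rw [← Finset.sum_filter, ← Finset.mul_sum]
  congr 1
  symm
  refine Finset.sum_bij (fun v _ => {v}) ?_ ?_ ?_ ?_
  · intro a _; simp
  · intro a _ b _ h; exact Finset.singleton_injective h
  · intro S hS
    obtain ⟨a, rfl⟩ := Finset.card_eq_one.1 (Finset.mem_filter.1 hS).2
    exact ⟨a, Finset.mem_univ _, rfl⟩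
  · intros; rfl

/-- Extinction lower bound, uniform initial mutant, restricted to a set `A`. -/
lemma ext_lower_unif [Nonempty V] {r : ℝ} (hr : 1 < r) {w : V → V → ℝ}
    (hw0 : ∀ u v, 0 ≤ w u v) (hw1 : ∀ u, ∑ v, w u v = 1)
    (g : Finset V → ℝ) (hg0 : ∀ S, 0 ≤ g S) (hg1 : ∀ S, g S ≤ 1) (hge : g ∅ = 1)
    (hd : ∀ S, S.Nonempty → 0 < g S → 0 < mfDrift r w g S)
    (A : Finset V) (c : ℝ) (hA : ∀ v ∈ A, c ≤ g {v}) :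
    (A.card : ℝ) * c / Fintype.card V ≤ extinctionProb r w (uniformSingleton V) := by
  have hn : (0 : ℝ) < Fintype.card V := by exact_mod_cast Fintype.card_pos
  have h1 : ∑ S, uniformSingleton V S = 1 := by
    have := sum_uniformSingleton_mul (V := V) (fun _ => 1)
    simp only [mul_one] at this
    rw [this]; simp [hn.ne']
  have h := ext_lower hr hw0 hw1 (init := uniformSingleton V) (fun S => by
    unfold uniformSingleton; split_ifs <;> positivity) h1 g hg0 hg1 hge hd
  rw [sum_uniformSingleton_mul] at h
  refine le_trans ?_ h
  rw [div_eq_inv_mul]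
  refine mul_le_mul_of_nonneg_left ?_ (by positivity)
  calc (A.card : ℝ) * c = ∑ v ∈ A, c := by simp
    _ ≤ ∑ v ∈ A, g {v} := Finset.sum_le_sum hA
    _ ≤ _ := Finset.sum_le_sum_of_subset_of_nonneg (Finset.subset_univ _) fun _ _ _ => hg0 _

/-- Case A: initial mutants which are overwritten at rate at least `q`. -/
lemma caseA [Nonempty V] {r : ℝ} (hr : 1 < r) {w : V → V → ℝ}
    (hw0 : ∀ u v, 0 ≤ w u v) (hw1 : ∀ u, ∑ v, w u v = 1)
    (A : Finset V) (q : ℝ) (hq : 0 < q) (hA : ∀ v ∈ A, w v v = 0 ∧ q ≤ ∑ u, w u v) :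
    (A.card : ℝ) * (q / (q + 2 * r)) / Fintype.card V ≤
      extinctionProb r w (uniformSingleton V) := by
  classical
  set c := q / (q + 2 * r) with hc
  have hc0 : 0 < c := by positivity
  have hc1 : c ≤ 1 := by rw [hc, div_le_one (by positivity)]; linarith
  have hcq : q * (1 - c) - r * c > 0 := by
    have : c * (q + 2 * r) = q := by rw [hc]; field_simp
    nlinarith
  set g : Finset V → ℝ := fun S => if S = ∅ then 1 else if ∃ v ∈ A, S = {v} then c else 0 with hg
  have hg0 : ∀ S, 0 ≤ g S := by
    intro S; simp only [hg]; split_ifs <;> first | positivity | exact hc0.le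
  refine ext_lower_unif hr hw0 hw1 g hg0 ?_ (by simp [hg]) ?_ A c ?_
  · intro S; simp only [hg]; split_ifs <;> first | exact hc1 | norm_num
  · intro S hS hgS
    have : ∃ v ∈ A, S = {v} := by
      by_contra hcon
      simp [hg, hS.ne_empty, hcon] at hgS
    obtain ⟨x, hx, rfl⟩ := this
    have hgx : g {x} = c := by simp [hg, hx]
    obtain ⟨hxx, hqx⟩ := hA x hx
    have hbound : ∀ u v, (if u = x then - (r * w x v * c) else 0) +
        (if v = x then w u x * (1 - c) else 0) ≤
        (if u ∈ ({x} : Finset V) then r else 1) * w u v * (g (mfNext {x} u v) - g {x}) := by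
      intro u v
      rw [hgx]
      by_cases hu : u = x
      · subst hu
        by_cases hv : v = u
        · subst hv; simp [hxx]
        · have h1 := mul_nonneg (mul_nonneg (by linarith : (0:ℝ) ≤ r) (hw0 u v))
            (hg0 (mfNext {u} u v))
          simp [hv]; linarith
      · by_cases hv : v = x
        · subst hv
          simp [hu, mfNext, hg]
        · have : mfNext {x} u v = {x} := by simp [mfNext, hu, hv]
          simp [hu, hv, this, hgx]
    unfold mfDrift
    refine lt_of_lt_of_le ?_ (Finset.sum_le_sum fun u _ => Finset.sum_le_sum fun v _ => hbound u v)
    simp_rw [Finset.sum_add_distrib]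
    have e1 : ∑ u : V, ∑ v : V, (if u = x then - (r * w x v * c) else 0) = - (r * c) := by
      rw [Finset.sum_eq_single x]
      · simp only [if_true]
        rw [Finset.sum_neg_distrib, ← Finset.sum_mul, ← Finset.mul_sum, hw1]; ring
      · intro b _ hb; simp [hb]
      · simp
    have e2 : ∑ u : V, ∑ v : V, (if v = x then w u x * (1 - c) else 0)
        = (∑ u, w u x) * (1 - c) := by
      simp [Finset.sum_mul]
    rw [e1, e2]
    nlinarith
  · intro v hv
    simp [hg, hv]

/-- Case B: product potential, stopped when there are two mutants in `K`. -/
lemma caseB [Nonempty V] {r : ℝ} (hr : 1 < r) {w : V → V → ℝ}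
    (hw0 : ∀ u v, 0 ≤ w u v) (hw1 : ∀ u, ∑ v, w u v = 1)
    (K : Finset V) (β : V → ℝ) (hβ : ∀ v, 0 < β v) (B : ℝ) (hB : ∀ v ∈ K, β v = B)
    (h1 : ∀ v, v ∉ K → β v ≤ r - 1) (c : V)
    (h2 : ∀ u, u ≠ c → (∀ v ∈ K, w u v = 0) ∧
      r * ∑ x, w u x * (β x / (1 + β x)) < (∑ x, w x u) * β u)
    (h3 : ∀ x ∈ K, w c x * B ≤ 1) (h4 : r + 1 < (∑ x, w x c) * β c)
    (h5 : ∀ x, x ∉ K → w c x = 0) :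
    (K.card : ℝ) * (1 / (1 + B)) / Fintype.card V ≤
      extinctionProb r w (uniformSingleton V) := by
  classical
  set g : Finset V → ℝ := fun S => if (S ∩ K).card ≤ 1 then ∏ v ∈ S, (1 + β v)⁻¹ else 0 with hg
  have hb1 : ∀ v, 0 < 1 + β v := fun v => by linarith [hβ v]
  have hg0 : ∀ S, 0 ≤ g S := by
    intro S; simp only [hg]; split_ifs
    · exact Finset.prod_nonneg fun v _ => (inv_pos.2 (hb1 v)).le
    · exact le_rfl
  refine ext_lower_unif hr hw0 hw1 g hg0 ?_ (by simp [hg]) ?_ K _ ?_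
  · intro S; simp only [hg]; split_ifs
    · exact Finset.prod_le_one (fun v _ => (inv_pos.2 (hb1 v)).le)
        fun v _ => inv_le_one_of_one_le₀ (by linarith [hβ v])
    · norm_num
  · intro S hS hgS
    have hSK : (S ∩ K).card ≤ 1 := by
      by_contra hcon
      simp [hg, hcon] at hgS
    set γ : V → ℝ := fun v => if v ∈ K then 1 else β v / (1 + β v) with hγ
    have hgS' : g S = ∏ v ∈ S, (1 + β v)⁻¹ := by simp [hg, hSK]
    have hbound : ∀ u v, g S * (w u v * ((if v ∈ S then β v else 0)
        - (if u ∈ S then r * γ v else 0)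
        + (if u ∈ S then (if v ∈ S then r * γ v - β v else 0) else 0))) ≤
        (if u ∈ S then r else 1) * w u v * (g (mfNext S u v) - g S) := by
      intro u v
      have hw := hw0 u v
      by_cases hu : u ∈ S <;> by_cases hv : v ∈ S
      · simp [hu, hv, mfNext]
      · have : g S * (1 - γ v) ≤ g (insert v S) := by
          by_cases hvK : v ∈ K
          · simp [hγ, hvK, hg0]
          · have e : (insert v S ∩ K) = S ∩ K := by
              rw [Finset.insert_inter_of_notMem hvK]
            have e2 : g (insert v S) = (1 + β v)⁻¹ * g S := by
              rw [hgS']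
              simp only [hg]
              rw [e, if_pos hSK, Finset.prod_insert hv]
            rw [e2]
            simp only [hγ, if_neg hvK]
            have := (hb1 v).ne'
            apply le_of_eq
            field_simp
            ring
        simp only [hu, hv, mfNext, if_true, if_false]
        have := mul_le_mul_of_nonneg_left this (mul_nonneg (by linarith : (0:ℝ) ≤ r) hw)
        nlinarith
      · have e : (S.erase v ∩ K).card ≤ 1 :=
          (Finset.card_le_card (Finset.inter_subset_inter_right (Finset.erase_subset _ _))).trans hSK
        have e2 : g (S.erase v) = g S * (1 + β v) := by
          rw [hgS']
          simp only [hg]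
          rw [if_pos e, ← Finset.mul_prod_erase S _ hv]
          have := (hb1 v).ne'
          field_simp
        simp only [hu, hv, mfNext, if_true, if_false, e2]
        apply le_of_eq; ring
      · simp [hu, hv, mfNext]
    unfold mfDrift
    refine lt_of_lt_of_le ?_ (Finset.sum_le_sum fun u _ => Finset.sum_le_sum fun v _ => hbound u v)
    simp_rw [← Finset.mul_sum]
    refine mul_pos hgS ?_
    simp_rw [mul_add, mul_sub, Finset.sum_add_distrib, Finset.sum_sub_distrib]
    have t1 : ∑ u : V, ∑ v : V, w u v * (if v ∈ S then β v else 0)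
        = ∑ u ∈ S, (∑ x, w x u) * β u := by
      rw [Finset.sum_comm]
      simp [Finset.sum_mul]
    have t2 : ∑ u : V, ∑ v : V, w u v * (if u ∈ S then r * γ v else 0)
        = ∑ u ∈ S, ∑ v, w u v * (r * γ v) := by
      rw [← Finset.sum_subset (Finset.subset_univ S)]
      · exact Finset.sum_congr rfl fun u hu => by simp [hu]
      · intro u _ hu; simp [hu]
    have t3 : ∑ u : V, ∑ v : V, w u v *
        (if u ∈ S then (if v ∈ S then r * γ v - β v else 0) else 0)
        = ∑ u ∈ S, ∑ v ∈ S, w u v * (r * γ v - β v) := by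
      rw [← Finset.sum_subset (Finset.subset_univ S)]
      · refine Finset.sum_congr rfl fun u hu => ?_
        rw [← Finset.sum_subset (Finset.subset_univ S)]
        · exact Finset.sum_congr rfl fun v hv => by simp [hu, hv]
        · intro v _ hv; simp [hv]
      · intro u _ hu; simp [hu]
    rw [t1, t2, t3, ← Finset.sum_sub_distrib, ← Finset.sum_add_distrib]
    refine Finset.sum_pos (fun u hu => ?_) hS
    have hgood : ∀ v, v ∉ K → 0 ≤ r * γ v - β v := by
      intro v hv
      simp only [hγ, if_neg hv]
      have h := h1 v hv
      have hb := hβ v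
      rw [sub_nonneg, ← mul_div_assoc, le_div_iff₀ (hb1 v)]
      nlinarith
    by_cases huc : u = c
    · subst huc
      have a1 : ∑ v, w u v * (r * γ v) = r := by
        have : ∀ v, w u v * (r * γ v) = r * w u v := by
          intro v
          by_cases hv : v ∈ K
          · simp [hγ, hv]; ring
          · simp [h5 v hv]
        simp_rw [this]
        rw [← Finset.mul_sum, hw1, mul_one]
      have a2 : -1 ≤ ∑ v ∈ S, w u v * (r * γ v - β v) := by
        have : ∑ v ∈ S, w u v * (r * γ v - β v) = ∑ v ∈ S ∩ K, w u v * (r * γ v - β v) := by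
          symm
          refine Finset.sum_subset Finset.inter_subset_left fun v hv hv' => ?_
          have : v ∉ K := fun hk => hv' (Finset.mem_inter.2 ⟨hv, hk⟩)
          simp [h5 v this]
        rw [this]
        have hle : ∀ v ∈ S ∩ K, (-1 : ℝ) ≤ w u v * (r * γ v - β v) := by
          intro v hv
          have hv := (Finset.mem_inter.1 hv).2
          have := h3 v hv
          have h6 := mul_nonneg (hw0 u v) (by linarith : (0:ℝ) ≤ r)
          simp only [hγ, if_pos hv, hB v hv]
          linarith
        have := Finset.card_nsmul_le_sum _ _ _ hle
        have hc : ((S ∩ K).card : ℝ) ≤ 1 := by exact_mod_cast hSK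
        simp only [nsmul_eq_mul] at this
        linarith
      rw [a1]; linarith
    · obtain ⟨hK, hlt⟩ := h2 u huc
      have a1 : ∑ v, w u v * (r * γ v) = r * ∑ x, w u x * (β x / (1 + β x)) := by
        rw [Finset.mul_sum]
        refine Finset.sum_congr rfl fun v _ => ?_
        by_cases hv : v ∈ K
        · simp [hK v hv]
        · simp [hγ, hv]; ring
      have a2 : 0 ≤ ∑ v ∈ S, w u v * (r * γ v - β v) := by
        refine Finset.sum_nonneg fun v _ => ?_
        by_cases hv : v ∈ K
        · simp [hK v hv]
        · exact mul_nonneg (hw0 u v) (hgood v hv)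
      rw [a1]; linarith
  · intro v hv
    have : (({v} : Finset V) ∩ K).card ≤ 1 :=
      (Finset.card_le_card Finset.inter_subset_left).trans (by simp)
    simp [hg, this, hB v hv]

end Generic

section Concrete

variable {k ℓ m : ℕ}

lemma mf_lev_inr (i : Fin k) (p : Fin ℓ × Fin (m ^ ((i : ℕ) + 1))) :
    mfLevel (Sum.inr ⟨i, p⟩ : MetafunnelV k ℓ m) = (i : ℕ) + 1 := rfl

lemma mf_copy_inr (i : Fin k) (j : Fin ℓ) (a : Fin (m ^ ((i : ℕ) + 1))) :
    mfCopy (Sum.inr ⟨i, j, a⟩ : MetafunnelV k ℓ m) = some j := rfl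

lemma mf_sum (f : ℕ → Option (Fin ℓ) → ℝ) :
    ∑ v : MetafunnelV k ℓ m, f (mfLevel v) (mfCopy v) =
      f 0 none + ∑ i : Fin k, ∑ j : Fin ℓ, (m : ℝ) ^ ((i : ℕ) + 1) * f (i + 1) (some j) := by
  rw [Fintype.sum_sum_type]
  congr 1
  · simp [mfLevel, mfCopy]
  · rw [Fintype.sum_sigma]
    refine Finset.sum_congr rfl fun i _ => ?_
    rw [Fintype.sum_prod_type]
    refine Finset.sum_congr rfl fun j _ => ?_
    simp [mfLevel, mfCopy]

lemma mf_sum_level (f : ℕ → ℝ) :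
    ∑ v : MetafunnelV k ℓ m, f (mfLevel v) =
      f 0 + ∑ i ∈ Finset.range k, (ℓ : ℝ) * (m : ℝ) ^ (i + 1) * f (i + 1) := by
  rw [mf_sum (fun L _ => f L), ← Fin.sum_univ_eq_sum_range
    (fun i => (ℓ : ℝ) * (m : ℝ) ^ (i + 1) * f (i + 1))]
  simp [mul_assoc]

lemma mf_card_level (p : ℕ → Prop) [DecidablePred p] :
    (((Finset.univ : Finset (MetafunnelV k ℓ m)).filter fun v => p (mfLevel v)).card : ℝ) =
      (if p 0 then 1 else 0) +
        ∑ i ∈ Finset.range k, (ℓ : ℝ) * (m : ℝ) ^ (i + 1) * (if p (i + 1) then 1 else 0) := by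
  rw [← mf_sum_level (fun i => if p i then (1 : ℝ) else 0), Finset.card_filter]
  push_cast
  rfl

lemma mf_card : (Fintype.card (MetafunnelV k ℓ m) : ℝ) =
    1 + ∑ i ∈ Finset.range k, (ℓ : ℝ) * (m : ℝ) ^ (i + 1) := by
  have := mf_sum_level (k := k) (ℓ := ℓ) (m := m) (fun _ => 1)
  simpa using this

lemma mf_card_top (hk : 1 ≤ k) :
    (((Finset.univ : Finset (MetafunnelV k ℓ m)).filter fun v => mfLevel v = k).card : ℝ) =
      (ℓ : ℝ) * (m : ℝ) ^ k := by
  rw [mf_card_level (fun i => i = k), if_neg (by omega), zero_add]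
  rw [Finset.sum_eq_single (k - 1)]
  · simp [Nat.sub_add_cancel hk]
  · intro b _ hb
    rw [if_neg (by omega), mul_zero]
  · intro h; simp at h; omega

lemma mf_card_mid (i : ℕ) (hi : i + 1 ≤ k) (j : Fin ℓ) :
    (((Finset.univ : Finset (MetafunnelV k ℓ m)).filter
      fun v => mfLevel v = i + 1 ∧ mfCopy v = some j).card : ℝ) = (m : ℝ) ^ (i + 1) := by
  rw [Finset.card_filter]
  push_cast
  rw [mf_sum (fun L C => if L = i + 1 ∧ C = some j then (1 : ℝ) else 0)]
  rw [if_neg (by simp), zero_add, Finset.sum_eq_single ⟨i, hi⟩, Finset.sum_eq_single j]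
  · simp
  · intro b _ hb; simp [hb]
  · simp
  · intro b _ hb
    have : ¬ ((b : ℕ) = i) := fun h => hb (Fin.ext h)
    simp [this]
  · simp

/-- weights as functions of the level and the copy -/
lemma mf_w_zero (hk : 1 ≤ k) (x : Unit) (v : MetafunnelV k ℓ m) :
    outWeights (metafunnelOut k ℓ m) (Sum.inl x) v =
      if mfLevel v = k then ((ℓ : ℝ) * (m : ℝ) ^ k)⁻¹ else 0 := by
  simp only [outWeights, metafunnelOut]
  rw [mf_card_top hk]
  simp

lemma mf_w_one (h : 0 < k) (p : Fin ℓ × Fin (m ^ (0 + 1))) (v : MetafunnelV k ℓ m) :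
    outWeights (metafunnelOut k ℓ m) (Sum.inr ⟨⟨0, h⟩, p⟩) v =
      if mfLevel v = 0 then 1 else 0 := by
  obtain ⟨j, a⟩ := p
  rcases v with v | ⟨i', j', a'⟩
  · simp [outWeights, metafunnelOut, mfLevel]
  · simp [outWeights, metafunnelOut, mfLevel]

lemma mf_w_mid (i : ℕ) (h : i + 1 < k) (j : Fin ℓ) (a : Fin (m ^ (i + 1 + 1)))
    (v : MetafunnelV k ℓ m) :
    outWeights (metafunnelOut k ℓ m) (Sum.inr ⟨⟨i + 1, h⟩, j, a⟩) v =
      if mfLevel v = i + 1 ∧ mfCopy v = some j then ((m : ℝ) ^ (i + 1))⁻¹ else 0 := by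
  simp only [outWeights, metafunnelOut, Nat.add_eq_zero_iff, one_ne_zero, and_false, if_false]
  rw [mf_card_mid i h.le]
  simp

lemma mf_w_nonneg (u v : MetafunnelV k ℓ m) : 0 ≤ outWeights (metafunnelOut k ℓ m) u v := by
  unfold outWeights; split_ifs <;> positivity

/-- Level of the out-neighbours. -/
def mfDown (k : ℕ) : ℕ → ℕ
  | 0 => k
  | i + 1 => i

lemma mf_out_sum (hk : 1 ≤ k) (hl : 1 ≤ ℓ) (hm : 1 ≤ m) (φ : ℕ → ℝ) (u : MetafunnelV k ℓ m) :
    ∑ v, outWeights (metafunnelOut k ℓ m) u v * φ (mfLevel v) = φ (mfDown k (mfLevel u)) := by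
  have hl' : (ℓ : ℝ) ≠ 0 := by positivity
  have hm' : (m : ℝ) ≠ 0 := by positivity
  rcases u with x | ⟨⟨i, hi⟩, p⟩
  · simp_rw [mf_w_zero hk]
    rw [mf_sum_level (fun L => (if L = k then ((ℓ : ℝ) * (m : ℝ) ^ k)⁻¹ else 0) * φ L)]
    rw [if_neg (by omega), Finset.sum_eq_single (k - 1)]
    · simp only [Nat.sub_add_cancel hk, if_true, mfLevel, mfDown]
      field_simp
      ring
    · intro b _ hb
      rw [if_neg (by omega)]; ring
    · intro h; simp at h; omega
  · rcases i with _ | i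
    · simp_rw [mf_w_one]
      rw [mf_sum_level (fun L => (if L = 0 then (1 : ℝ) else 0) * φ L)]
      simp [mfLevel, mfDown]
    · obtain ⟨j, a⟩ := p
      simp_rw [mf_w_mid]
      rw [mf_sum (fun L C => (if L = i + 1 ∧ C = some j then ((m : ℝ) ^ (i + 1))⁻¹ else 0) * φ L)]
      rw [if_neg (by simp), Finset.sum_eq_single ⟨i, by omega⟩, Finset.sum_eq_single j]
      · simp only [mfLevel, mfDown, and_self, if_true]
        field_simp
        ring
      · intro b _ hb; simp [hb]
      · simp
      · intro b _ hb
        have : ¬ ((b : ℕ) = i) := fun h => hb (Fin.ext h)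
        simp [this]
      · simp

/-- weight as a function of levels and copies -/
noncomputable def mfOmega (k ℓ m : ℕ) (L : ℕ) (C : Option (Fin ℓ)) (L' : ℕ) (C' : Option (Fin ℓ)) :
    ℝ :=
  if L = 0 then (if L' = k then ((ℓ : ℝ) * (m : ℝ) ^ k)⁻¹ else 0)
  else if L = 1 then (if L' = 0 then 1 else 0)
  else if L' + 1 = L ∧ C' = C then ((m : ℝ) ^ L')⁻¹ else 0

lemma mf_w_omega (hk : 1 ≤ k) (u v : MetafunnelV k ℓ m) :
    outWeights (metafunnelOut k ℓ m) u v =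
      mfOmega k ℓ m (mfLevel u) (mfCopy u) (mfLevel v) (mfCopy v) := by
  rcases u with x | ⟨⟨i, hi⟩, p⟩
  · rw [mf_w_zero hk]; simp [mfOmega, mfLevel]
  · rcases i with _ | i
    · rw [mf_w_one]; simp only [mfOmega]; simp [mfLevel]
    · obtain ⟨j, a⟩ := p
      rw [mf_w_mid]
      unfold mfOmega
      have z1 : ¬ (i + 1 + 1 = 0) := by omega
      have z2 : ¬ (i + 1 + 1 = 1) := by omega
      rw [mf_lev_inr, mf_copy_inr, if_neg z1, if_neg z2]
      simp only [Nat.add_right_cancel_iff]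
      by_cases hh : mfLevel v = i + 1 ∧ mfCopy v = some j
      · rw [if_pos hh, if_pos hh, hh.1]
      · rw [if_neg hh, if_neg hh]

/-- in-rates -/
lemma mf_in_sum (hk : 1 ≤ k) (hl : 1 ≤ ℓ) (hm : 1 ≤ m) (v : MetafunnelV k ℓ m) :
    ∑ u, outWeights (metafunnelOut k ℓ m) u v =
      if mfLevel v = 0 then (ℓ : ℝ) * m else
      if mfLevel v = k then ((ℓ : ℝ) * (m : ℝ) ^ k)⁻¹ else m := by
  have hl' : (ℓ : ℝ) ≠ 0 := by positivity
  have hm' : (m : ℝ) ≠ 0 := by positivity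
  simp_rw [mf_w_omega hk]
  rw [mf_sum (fun L C => mfOmega k ℓ m L C (mfLevel v) (mfCopy v))]
  rcases v with x | ⟨⟨i, hi⟩, ⟨j, a⟩⟩
  · simp only [mfLevel, mfCopy, if_true]
    rw [Finset.sum_eq_single ⟨0, hk⟩]
    · have h0 : ¬ (0 = k) := by omega
      simp only [mfOmega, if_neg h0]; simp
    · intro b _ hb
      have : ¬ ((b : ℕ) = 0) := fun h => hb (Fin.ext h)
      simp [mfOmega, this]
    · simp
  · simp only [mfLevel, mfCopy]
    by_cases hik : i + 1 = k
    · rw [Finset.sum_eq_zero]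
      · have h0 : ¬ (k = 0) := by omega
        simp [mfOmega, hik, h0]
      · intro b _
        refine Finset.sum_eq_zero fun c _ => ?_
        have : ¬ (i + 1 = (b : ℕ)) := by have := b.2; omega
        simp [mfOmega, this]
    · rw [Finset.sum_eq_single ⟨i + 1, by omega⟩, Finset.sum_eq_single j]
      · simp [mfOmega, hik]
        field_simp
        ring
      · intro b _ hb
        simp [mfOmega, Ne.symm hb]
      · simp
      · intro b _ hb
        have : ¬ (i + 1 = (b : ℕ)) := fun h => hb (Fin.ext h.symm)
        simp [mfOmega, this]
      · simp

lemma mf_w_self (hk : 1 ≤ k) (v : MetafunnelV k ℓ m) (h1 : mfLevel v ≠ 0) :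
    outWeights (metafunnelOut k ℓ m) v v = 0 := by
  rw [mf_w_omega hk]
  simp [mfOmega, h1]

lemma mf_row (hk : 1 ≤ k) (hl : 1 ≤ ℓ) (hm : 1 ≤ m) (u : MetafunnelV k ℓ m) :
    ∑ v, outWeights (metafunnelOut k ℓ m) u v = 1 := by
  simpa using mf_out_sum hk hl hm (fun _ => 1) u

lemma mf_caseA (hk : 1 ≤ k) (hl : 1 ≤ ℓ) (hm : 1 ≤ m) :
    (1 : ℝ) / (21 * m) ≤ extinctionProb 3 (outWeights (metafunnelOut (k + 1) ℓ m))
      (uniformSingleton (MetafunnelV (k + 1) ℓ m)) := by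
  have hm' : (1 : ℝ) ≤ m := by exact_mod_cast hm
  have hl' : (1 : ℝ) ≤ ℓ := by exact_mod_cast hl
  have key := caseA (V := MetafunnelV (k + 1) ℓ m) (r := 3) (by norm_num)
    (fun u v => mf_w_nonneg u v) (fun u => mf_row (by omega) hl hm u)
    (Finset.univ.filter fun v => mfLevel v ≠ 0 ∧ mfLevel v ≠ k + 1) m (by positivity) (by
      intro v hv
      simp only [Finset.mem_filter, Finset.mem_univ, true_and] at hv
      refine ⟨mf_w_self (by omega) v hv.1, ?_⟩
      rw [mf_in_sum (by omega) hl hm, if_neg hv.1, if_neg hv.2])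
  refine le_trans ?_ key
  rw [mf_card_level (fun i => i ≠ 0 ∧ i ≠ k + 1), mf_card]
  rw [Finset.sum_range_succ, Finset.sum_range_succ]
  have e : ∑ i ∈ Finset.range k, (ℓ : ℝ) * (m : ℝ) ^ (i + 1) *
      (if i + 1 ≠ 0 ∧ i + 1 ≠ k + 1 then 1 else 0) =
      ∑ i ∈ Finset.range k, (ℓ : ℝ) * (m : ℝ) ^ (i + 1) := by
    refine Finset.sum_congr rfl fun i hi => ?_
    rw [Finset.mem_range] at hi
    rw [if_pos ⟨by omega, by omega⟩, mul_one]
  rw [e]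
  set A := ∑ i ∈ Finset.range k, (ℓ : ℝ) * (m : ℝ) ^ (i + 1) with hA
  have hAk : (ℓ : ℝ) * (m : ℝ) ^ k ≤ A := by
    have := Finset.single_le_sum (f := fun i => (ℓ : ℝ) * (m : ℝ) ^ (i + 1)) (s := Finset.range k)
      (fun i _ => by positivity) (Finset.mem_range.2 (by omega : k - 1 < k))
    simpa [Nat.sub_add_cancel hk] using this
  have hA1 : 1 ≤ A := le_trans (one_le_mul_of_one_le_of_one_le hl' (one_le_pow₀ hm')) hAk
  have hB : (ℓ : ℝ) * (m : ℝ) ^ (k + 1) ≤ m * A := by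
    rw [pow_succ]; nlinarith
  simp only [ne_eq, not_true_eq_false, and_false, false_and, if_false, mul_zero, add_zero, zero_add]
  have h1 : A * (m / (m + 2 * 3)) / ((m + 2) * A) ≤
      A * (m / (m + 2 * 3)) / (1 + (A + (ℓ : ℝ) * (m : ℝ) ^ (k + 1))) := by
    apply div_le_div_of_nonneg_left <;> first | positivity | nlinarith
  refine le_trans ?_ h1
  have : A * (m / (m + 2 * 3)) / ((m + 2) * A) = m / ((m + 2 * 3) * (m + 2)) := by
    have : A ≠ 0 := by positivity
    field_simp
  rw [this, div_le_div_iff₀ (by positivity) (by positivity)]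
  nlinarith

lemma mf_caseB (hk : 1 ≤ k) (hl : 1 ≤ ℓ) (hm : 1 ≤ m)
    (h : 15 ≤ m ∨ (k = 1 ∧ 15 ≤ ℓ * m)) :
    (1 : ℝ) / (18 * 3 ^ k) ≤ extinctionProb 3 (outWeights (metafunnelOut k ℓ m))
      (uniformSingleton (MetafunnelV k ℓ m)) := by
  have hm' : (1 : ℝ) ≤ m := by exact_mod_cast hm
  have hl' : (1 : ℝ) ≤ ℓ := by exact_mod_cast hl
  have hlm : (15 : ℝ) ≤ ℓ * m := by
    rcases h with h | h
    · have : (15 : ℝ) ≤ m := by exact_mod_cast h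
      nlinarith
    · exact_mod_cast h.2
  have hbig : 5 * (3 : ℝ) ^ k ≤ ℓ * (m : ℝ) ^ k := by
    rcases h with h | h
    · have h15 : (15 : ℝ) ≤ m := by exact_mod_cast h
      calc 5 * (3 : ℝ) ^ k ≤ 5 ^ k * 3 ^ k := by
            gcongr
            exact le_self_pow₀ (by norm_num) (by omega)
        _ = (15 : ℝ) ^ k := by rw [← mul_pow]; norm_num
        _ ≤ (m : ℝ) ^ k := by gcongr
        _ ≤ ℓ * (m : ℝ) ^ k := le_mul_of_one_le_left (by positivity) hl'
    · rw [h.1]; linarith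
  set b : ℕ → ℝ := fun i => if i = k then 5 * 3 ^ k else (3 / (m : ℝ)) ^ i * (5 / (ℓ * m)) with hb
  have hbpos : ∀ i, 0 < b i := by
    intro i; simp only [hb]; split_ifs <;> positivity
  have key := caseB (V := MetafunnelV k ℓ m) (r := 3) (by norm_num)
    (fun u v => mf_w_nonneg u v) (fun u => mf_row hk hl hm u)
    (Finset.univ.filter fun v => mfLevel v = k) (fun v => b (mfLevel v)) (fun v => hbpos _)
    (5 * 3 ^ k) (fun v hv => by
      simp only [Finset.mem_filter, Finset.mem_univ, true_and] at hv
      simp [hb, hv])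
    (by
      intro v hv
      simp only [Finset.mem_filter, Finset.mem_univ, true_and] at hv
      have hlev : mfLevel v < k := by
        rcases v with x | ⟨i, p⟩
        · exact hk
        · have := i.2; simp only [mfLevel] at hv ⊢; omega
      simp only [hb, if_neg hv]
      have h5 : 5 / ((ℓ : ℝ) * m) ≤ 1 := by
        rw [div_le_one (by positivity)]; linarith
      have h6 : (3 / (m : ℝ)) ^ mfLevel v ≤ 1 := by
        rcases h with h | h
        · have h15 : (15 : ℝ) ≤ m := by exact_mod_cast h
          apply pow_le_one₀ (by positivity)
          rw [div_le_one (by positivity)]; linarith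
        · rw [(by omega : mfLevel v = 0)]; simp
      have h7 : (3 / (m : ℝ)) ^ mfLevel v * (5 / (ℓ * m)) ≤ 1 :=
        mul_le_one₀ h6 (by positivity) h5
      linarith)
    (Sum.inl ())
    (by
      intro u hu
      rcases u with x | ⟨⟨i, hi⟩, p⟩
      · exact absurd rfl hu
      refine ⟨?_, ?_⟩
      · intro v hv
        simp only [Finset.mem_filter, Finset.mem_univ, true_and] at hv
        rw [mf_w_omega hk]
        have h1 : ¬ (k + 1 = i + 1) := by omega
        have h2 : k ≠ 0 := by omega
        rw [hv, mf_lev_inr]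
        have h3 : ¬ (k = i) := by omega
        simp [mfOmega, h2, h3]
      · have e := mf_out_sum hk hl hm (fun L => b L / (1 + b L))
          (Sum.inr ⟨⟨i, hi⟩, p⟩ : MetafunnelV k ℓ m)
        rw [e, mf_in_sum hk hl hm]
        rw [mf_lev_inr, if_neg (Nat.succ_ne_zero i)]
        simp only [mfDown]
        have hlt : b i / (1 + b i) < b i := by
          have := hbpos i
          rw [div_lt_iff₀ (by positivity)]
          nlinarith
        have hbi : b i = (3 / (m : ℝ)) ^ i * (5 / (ℓ * m)) := by
          have h3 : ¬ (i = k) := by omega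
          simp only [hb, if_neg h3]
        have hgoal : 3 * b i = (if i + 1 = k then ((ℓ : ℝ) * (m : ℝ) ^ k)⁻¹ else (m : ℝ))
            * b (i + 1) := by
          rw [hbi]
          by_cases hik : i + 1 = k
          · simp only [hb, if_pos hik]
            rw [← hik, div_pow]
            field_simp
            ring
          · simp only [hb, if_neg hik]
            rw [pow_succ]
            field_simp
        rw [← hgoal]
        linarith)
    (by
      intro v hv
      simp only [Finset.mem_filter, Finset.mem_univ, true_and] at hv
      rw [mf_w_zero hk, if_pos hv, inv_mul_le_iff₀ (by positivity)]
      linarith)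
    (by
      rw [mf_in_sum hk hl hm]
      simp only [mfLevel, if_true, hb, if_neg (by omega : ¬ 0 = k)]
      field_simp
      norm_num)
    (by
      intro v hv
      simp only [Finset.mem_filter, Finset.mem_univ, true_and] at hv
      rw [mf_w_zero hk, if_neg hv])
  refine le_trans ?_ key
  rw [mf_card_top hk, mf_card]
  obtain ⟨k', rfl⟩ : ∃ k', k = k' + 1 := ⟨k - 1, by omega⟩
  rw [Finset.sum_range_succ]
  set Q := (ℓ : ℝ) * (m : ℝ) ^ (k' + 1) with hQ
  have hQ1 : 1 ≤ Q := one_le_mul_of_one_le_of_one_le hl' (one_le_pow₀ hm')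
  have hA : ∑ i ∈ Finset.range k', (ℓ : ℝ) * (m : ℝ) ^ (i + 1) ≤ Q := by
    rcases h with h | h
    · have h15 : (15 : ℝ) ≤ m := by exact_mod_cast h
      rw [hQ, ← Finset.mul_sum]
      gcongr
      clear * - h15
      induction k' with
      | zero => simp
      | succ j ih =>
        rw [Finset.sum_range_succ]
        have : (0 : ℝ) ≤ (m : ℝ) ^ (j + 1) := by positivity
        rw [pow_succ (m : ℝ) (j + 1)]
        nlinarith
    · rw [(by omega : k' = 0)]; simp only [Finset.range_zero, Finset.sum_empty]; linarith
  have hp : (1 : ℝ) ≤ 3 ^ (k' + 1) := one_le_pow₀ (by norm_num)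
  have h0 : (0 : ℝ) ≤ ∑ i ∈ Finset.range k', (ℓ : ℝ) * (m : ℝ) ^ (i + 1) :=
    Finset.sum_nonneg fun i _ => by positivity
  rw [mul_one_div, div_div, div_le_div_iff₀ (by positivity) (by positivity), one_mul]
  calc (1 + 5 * (3 : ℝ) ^ (k' + 1)) * (1 + (∑ i ∈ Finset.range k', (ℓ : ℝ) * (m : ℝ) ^ (i + 1) + Q))
      ≤ (6 * 3 ^ (k' + 1)) * (3 * Q) := by
        gcongr
        · linarith
        · linarith
    _ = _ := by ring

end Concrete

lemma mf_bound {k ℓ m : ℕ} (hk : 1 ≤ k) (hl : 1 ≤ ℓ) (hm : 1 ≤ m)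
    (hn : 16 ≤ Fintype.card (MetafunnelV k ℓ m)) :
    Real.exp (-(2 * √(Real.log (Fintype.card (MetafunnelV k ℓ m))))) / 400 ≤
      extinctionProb 3 (outWeights (metafunnelOut k ℓ m))
        (uniformSingleton (MetafunnelV k ℓ m)) := by
  set n := Fintype.card (MetafunnelV k ℓ m) with hnn
  have hcard : (n : ℝ) = _ := mf_card (k := k) (ℓ := ℓ) (m := m)
  set s := √(Real.log (n : ℝ)) with hs
  have hs0 : 0 ≤ s := Real.sqrt_nonneg _
  have hm' : (1 : ℝ) ≤ m := by exact_mod_cast hm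
  have hl' : (1 : ℝ) ≤ ℓ := by exact_mod_cast hl
  have hexp1 : Real.exp (-(2 * s)) ≤ 1 := by
    rw [Real.exp_le_one_iff]; linarith
  have hexp0 := Real.exp_pos (-(2 * s))
  rcases hk.eq_or_lt with h1 | h1
  · subst h1
    refine le_trans ?_ (mf_caseB hk hl hm (Or.inr ⟨rfl, ?_⟩))
    · norm_num; linarith
    · have : ((n : ℕ) : ℝ) = ((1 + ℓ * m : ℕ) : ℝ) := by rw [hcard]; simp
      have := Nat.cast_injective this
      omega
  obtain ⟨k', rfl⟩ : ∃ k', k = k' + 1 := ⟨k - 1, by omega⟩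
  by_cases h15 : 15 ≤ m
  · have h15' : (15 : ℝ) ≤ m := by exact_mod_cast h15
    have hmn : (m : ℝ) ^ (k' + 1) ≤ n := by
      rw [hcard, Finset.sum_range_succ]
      have h0 : (0 : ℝ) ≤ ∑ i ∈ Finset.range k', (ℓ : ℝ) * (m : ℝ) ^ (i + 1) :=
        Finset.sum_nonneg fun i _ => by positivity
      have : (m : ℝ) ^ (k' + 1) ≤ ℓ * (m : ℝ) ^ (k' + 1) :=
        le_mul_of_one_le_left (by positivity) hl'
      linarith
    have hlog : ((k' + 1 : ℕ) : ℝ) * Real.log m ≤ s * s := by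
      rw [hs, Real.mul_self_sqrt (Real.log_nonneg (by exact_mod_cast (by omega : 1 ≤ n))),
        ← Real.log_pow]
      exact Real.log_le_log (by positivity) hmn
    by_cases hks : ((k' + 1 : ℕ) : ℝ) ≤ s
    · refine le_trans ?_ (mf_caseB hk hl hm (Or.inl h15))
      have h3 : (3 : ℝ) ^ (k' + 1) ≤ Real.exp (2 * s) := by
        have : (3 : ℝ) ≤ Real.exp 2 := by have := Real.add_one_le_exp (2 : ℝ); linarith
        calc (3 : ℝ) ^ (k' + 1) ≤ Real.exp 2 ^ (k' + 1) := by gcongr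
          _ = Real.exp (((k' + 1 : ℕ) : ℝ) * 2) := by rw [Real.exp_nat_mul]
          _ ≤ Real.exp (2 * s) := by rw [Real.exp_le_exp]; linarith
      rw [Real.exp_neg, div_le_div_iff₀ (by norm_num) (by positivity),
        inv_mul_le_iff₀ (Real.exp_pos _)]
      nlinarith [Real.exp_pos (2 * s)]
    · refine le_trans ?_ (mf_caseA (by omega) hl hm)
      have hlogm : Real.log m ≤ s := by
        by_contra hcon
        push Not at hcon hks
        nlinarith
      have hme : (m : ℝ) ≤ Real.exp (2 * s) := by
        rw [← Real.log_le_iff_le_exp (by positivity)]; linarith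
      rw [Real.exp_neg, div_le_div_iff₀ (by norm_num) (by positivity),
        inv_mul_le_iff₀ (Real.exp_pos _)]
      nlinarith [Real.exp_pos (2 * s)]
  · refine le_trans ?_ (mf_caseA (by omega) hl hm)
    have : (m : ℝ) ≤ 15 := by exact_mod_cast (by omega : m ≤ 15)
    rw [div_le_div_iff₀ (by norm_num) (by positivity)]
    nlinarith

lemma mf_asymp (ε : ℝ) (hε : ε < 1 / 2) :
    ∃ N : ℕ, ∀ n : ℕ, N ≤ n →
      (n : ℝ) ^ (-(1 / Real.log (n : ℝ) ^ ε)) < Real.exp (-(2 * √(Real.log n))) / 400 := by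
  have hlog : Filter.Tendsto (fun n : ℕ => Real.log (n : ℝ)) Filter.atTop Filter.atTop :=
    Real.tendsto_log_atTop.comp tendsto_natCast_atTop_atTop
  have h1 := (tendsto_rpow_atTop (by linarith : (0 : ℝ) < 1 / 2 - ε)).comp hlog
  have hev := (h1.eventually_ge_atTop (402 : ℝ)).and (hlog.eventually_ge_atTop 1)
  obtain ⟨N, hN⟩ := Filter.eventually_atTop.1 hev
  refine ⟨max N 1, fun n hn => ?_⟩
  obtain ⟨ha, hb⟩ := hN n (le_trans (le_max_left _ _) hn)
  have hn1 : 1 ≤ n := le_trans (le_max_right _ _) hn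
  have hn0 : (0 : ℝ) < n := by exact_mod_cast hn1
  simp only [Function.comp] at ha
  set L := Real.log (n : ℝ) with hL
  have hL0 : 0 < L := by linarith
  have e1 : L * (1 / L ^ ε) = √L * L ^ (1 / 2 - ε) := by
    rw [Real.sqrt_eq_rpow, ← Real.rpow_add hL0, mul_one_div]
    nth_rewrite 1 [← Real.rpow_one L]
    rw [← Real.rpow_sub hL0]
    congr 1; ring
  have hs1 : 1 ≤ √L := by rw [Real.one_le_sqrt]; exact hb
  have h400 : (400 : ℝ) < Real.exp 400 := by
    have := Real.add_one_le_exp (400 : ℝ); linarith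
  rw [Real.rpow_def_of_pos hn0, ← hL, mul_neg, e1, lt_div_iff₀ (by norm_num)]
  calc Real.exp (-(√L * L ^ (1 / 2 - ε))) * 400
      < Real.exp (-(√L * L ^ (1 / 2 - ε))) * Real.exp 400 := by
        gcongr
    _ = Real.exp (-(√L * L ^ (1 / 2 - ε)) + 400) := by rw [Real.exp_add]
    _ ≤ Real.exp (-(2 * √L)) := by
        rw [Real.exp_le_exp]; nlinarith

lemma mf_large {F : Set (ℕ × ℕ × ℕ)} (hF : F.Infinite)
    (hF1 : ∀ p ∈ F, 1 ≤ p.1 ∧ 1 ≤ p.2.1 ∧ 1 ≤ p.2.2) (N : ℕ) :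
    ∃ k ℓ m : ℕ, (k, ℓ, m) ∈ F ∧ N ≤ Fintype.card (MetafunnelV k ℓ m) := by
  by_contra hcon
  push Not at hcon
  apply hF
  refine Set.Finite.subset (Set.finite_Iic ((N, N, N) : ℕ × ℕ × ℕ)) ?_
  rintro ⟨k, ℓ, m⟩ hp
  have hlt := hcon k ℓ m hp
  obtain ⟨hk, hl, hm⟩ := hF1 _ hp
  simp only at hk hl hm
  have hc : (Fintype.card (MetafunnelV k ℓ m) : ℝ) =
      ((1 + ∑ i ∈ Finset.range k, ℓ * m ^ (i + 1) : ℕ) : ℝ) := by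
    rw [mf_card]; push_cast; rfl
  have hc := Nat.cast_injective hc
  have h1 : k ≤ ∑ i ∈ Finset.range k, ℓ * m ^ (i + 1) := by
    calc k = ∑ i ∈ Finset.range k, 1 := by simp
      _ ≤ _ := Finset.sum_le_sum fun i _ => Nat.mul_pos hl (pow_pos hm _)
  have h2 : ℓ * m ≤ ∑ i ∈ Finset.range k, ℓ * m ^ (i + 1) := by
    have := Finset.single_le_sum (f := fun i => ℓ * m ^ (i + 1)) (s := Finset.range k)
      (fun i _ => Nat.zero_le _) (Finset.mem_range.2 (by omega : 0 < k))
    simpa using this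
  have h3 : ℓ ≤ ℓ * m := Nat.le_mul_of_pos_right _ hm
  have h4 : m ≤ ℓ * m := Nat.le_mul_of_pos_left _ hl
  simp only [Set.mem_Iic, Prod.mk_le_mk]
  refine ⟨?_, ?_, ?_⟩ <;> omega

/-- **No metafunnel family is strongly amplifying, quantitatively** (Theorem 1.10).
Fix `0 < ε < 1/2` and let `ζ(r,n) = n^{-1/(log n)^ε}`.  Then no infinite family of
metafunnels is up-to-`ζ` fixating. -/
theorem no_metafunnel_family_up_to_zeta_fixating
    (ε : ℝ) (hε0 : 0 < ε) (hε : ε < 1 / 2)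
    (F : Set (ℕ × ℕ × ℕ)) (hF : F.Infinite)
    (hF1 : ∀ p ∈ F, 1 ≤ p.1 ∧ 1 ≤ p.2.1 ∧ 1 ≤ p.2.2) :
    ¬ UpToZetaFixatingMetafunnels
        (fun _ n => (n : ℝ) ^ (-(1 / Real.log (n : ℝ) ^ ε))) F := by
  intro hfix
  obtain ⟨n₀, h⟩ := hfix 3 (by norm_num)
  obtain ⟨N, hN⟩ := mf_asymp ε hε
  obtain ⟨k, ℓ, m, hp, hn⟩ := mf_large hF hF1 (max n₀ (max N 16))
  have h1 := h k ℓ m hp (le_trans (le_max_left _ _) hn)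
  have hn' := le_trans (le_max_right _ _) hn
  have h2 := hN _ (le_trans (le_max_left _ _) hn')
  obtain ⟨hk, hl, hm⟩ := hF1 _ hp
  have h3 := mf_bound hk hl hm (le_trans (le_max_right _ _) hn')
  exact absurd (h3.trans h1) (not_le.2 h2)
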